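/- arXiv:2310.18617 — 4 statements merged into one kernel-verified Lean document; each statement's English description precedes it below -/
import Mathlib

section
/- Let Π be a nonempty set, 𝒮 a nonempty collection of subsets of Π, and g, g̃ : 𝒮 → ℝ two set functions. Let c : 𝒮 → ℝ satisfy |g(S) − g̃(S)| ≤ c(S) for all S ∈ 𝒮, and define the lower bound L : 𝒮 → ℝ by L(S) = g̃(S) − c(S). Suppose S* ∈ 𝒮 satisfies g(S*) ≥ g(S) for all S ∈ 𝒮, and S̃ ∈ 𝒮 satisfies L(S̃) ≥ L(S) for all S ∈ 𝒮. Let α ∈ [0, 1] and let Ŝ ∈ 𝒮 satisfy L(Ŝ) ≥ α · L(S̃). Then g(Ŝ) ≥ α · g(S*) − 2 c(S*). -/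
/-- **Lemma 3 (approximate maximization with pessimism).**
If `g'` approximates `g` within error `c` on a nonempty collection `𝒮` of subsets of a
nonempty set `Π`, `L S = g' S - c S` is the pessimistic lower bound, `Sstar` maximizes `g`
over `𝒮`, `Stilde` maximizes `L` over `𝒮`, and `Shat ∈ 𝒮` is an `α`-approximate maximizer
of `L` for `α ∈ [0, 1]`, then `g Shat ≥ α * g Sstar - 2 * c Sstar`. -/
theorem stmt_1 {P : Type*} [Nonempty P] (𝒮 : Set (Set P)) (h𝒮 : 𝒮.Nonempty)
    (g g' c : Set P → ℝ)
    (hc : ∀ S ∈ 𝒮, |g S - g' S| ≤ c S)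
    (L : Set P → ℝ) (hL : ∀ S, L S = g' S - c S)
    (Sstar : Set P) (hSstar : Sstar ∈ 𝒮) (hgmax : ∀ S ∈ 𝒮, g S ≤ g Sstar)
    (Stilde : Set P) (hStilde : Stilde ∈ 𝒮) (hLmax : ∀ S ∈ 𝒮, L S ≤ L Stilde)
    (α : ℝ) (hα0 : 0 ≤ α) (hα1 : α ≤ 1)
    (Shat : Set P) (hShat : Shat ∈ 𝒮) (happrox : L Shat ≥ α * L Stilde) :
    g Shat ≥ α * g Sstar - 2 * c Sstar := by
  have hcstar : 0 ≤ c Sstar := (abs_nonneg _).trans (hc Sstar hSstar)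
  have hLg : L Shat ≤ g Shat := by
    rw [hL]
    linarith [(abs_le.mp (hc Shat hShat)).1]
  have hLstar : g Sstar - 2 * c Sstar ≤ L Sstar := by
    rw [hL]
    linarith [(abs_le.mp (hc Sstar hSstar)).2]
  have hmul : α * (g Sstar - 2 * c Sstar) ≤ α * L Stilde :=
    mul_le_mul_of_nonneg_left (hLstar.trans (hLmax Sstar hSstar)) hα0
  have hαc : α * c Sstar ≤ c Sstar := mul_le_of_le_one_left hcstar hα1
  linarith
end

section
/- Let S be a finite set, m a positive integer, and let V, Ṽ : S → [0,1]^m assign to each π ∈ S vectors with coordinates V_i(π), Ṽ_i(π) ∈ [0,1]. Assume |V_i(π) − Ṽ_i(π)| ≤ c_i(π) for all i ∈ {1,…,m} and π ∈ S, where c_i(π) ≥ 0. Then |vol(S, V) − vol(S, Ṽ)| ≤ Σ_{π ∈ S} Σ_{i=1}^m c_i(π). -/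
open MeasureTheory

/-- The hypervolume indicator of a finite set `S` of policies under value function `V`:
the Lebesgue measure of `⋃ π ∈ S, ∏_{i} [0, V π i]`. -/
noncomputable def vol {P : Type*} {m : ℕ} (S : Finset P) (V : P → Fin m → ℝ) : ℝ :=
  (volume (⋃ π ∈ S, Set.Icc (0 : Fin m → ℝ) (V π))).toReal

lemma volume_real_Icc_update_le {m : ℕ} (i : Fin m) {a b c : ℝ} (h_c : 0 ≤ c)
    (h_sub : b - a ≤ c) :
    volume.real (Set.Icc (Function.update (0 : Fin m → ℝ) i a)
      (Function.update (1 : Fin m → ℝ) i b)) ≤ c := by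
  rw [measureReal_def, Real.volume_Icc_pi, ENNReal.toReal_prod, Finset.prod_eq_single i]
  · simpa [ENNReal.toReal_ofReal'] using ⟨by linarith, h_c⟩
  · intro j _ hj
    simp [Function.update_of_ne hj]
  · simp

lemma vol_le_vol_add {P : Type*} {m : ℕ} (S : Finset P) (A B c : P → Fin m → ℝ)
    (hA : ∀ π ∈ S, ∀ i, A π i ≤ 1) (hc0 : ∀ π ∈ S, ∀ i, 0 ≤ c π i)
    (hc : ∀ π ∈ S, ∀ i, A π i - B π i ≤ c π i) :
    vol S A ≤ vol S B + ∑ π ∈ S, ∑ i, c π i := by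
  let slab (π : P) (i : Fin m) : Set (Fin m → ℝ) :=
    Set.Icc (Function.update 0 i (B π i)) (Function.update 1 i (A π i))
  have h_sub : (⋃ π ∈ S, Set.Icc (0 : Fin m → ℝ) (A π)) ⊆
      (⋃ π ∈ S, Set.Icc (0 : Fin m → ℝ) (B π)) ∪
        ⋃ π ∈ S, ⋃ i ∈ (Finset.univ : Finset (Fin m)), slab π i := by
    intro x hx
    simp only [Set.mem_iUnion, exists_prop] at hx
    obtain ⟨π, hπ, h0, hxA⟩ := hx
    by_cases hxB : x ≤ B π
    · exact Or.inl (Set.mem_biUnion hπ ⟨h0, hxB⟩)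
    · simp only [Pi.le_def, not_forall, not_le] at hxB
      obtain ⟨i, hi⟩ := hxB
      refine Or.inr (Set.mem_biUnion hπ (Set.mem_biUnion (Finset.mem_univ i) ⟨?_, ?_⟩))
      · exact update_le_iff.2 ⟨hi.le, fun j _ => h0 j⟩
      · exact le_update_iff.2 ⟨hxA i, fun j _ => (hxA j).trans (hA π hπ j)⟩
  have h_fin : volume ((⋃ π ∈ S, Set.Icc (0 : Fin m → ℝ) (B π)) ∪
      ⋃ π ∈ S, ⋃ i ∈ (Finset.univ : Finset (Fin m)), slab π i) ≠ ⊤ :=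
    IsCompact.measure_ne_top <| (S.isCompact_biUnion fun _ _ => isCompact_Icc).union <|
      S.isCompact_biUnion fun _ _ => Finset.univ.isCompact_biUnion fun _ _ => isCompact_Icc
  calc vol S A ≤ _ := measureReal_mono h_sub h_fin
    _ ≤ vol S B + _ := measureReal_union_le _ _
    _ ≤ vol S B + ∑ π ∈ S, ∑ i, c π i := by
      gcongr
      refine (measureReal_biUnion_finset_le _ _).trans (Finset.sum_le_sum fun π hπ => ?_)
      refine (measureReal_biUnion_finset_le _ _).trans (Finset.sum_le_sum fun i _ => ?_)
      exact volume_real_Icc_update_le i (hc0 π hπ i) (hc π hπ i)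

/-- **Lemma 4 (hypervolume approximation error).** If `|V π i - Vt π i| ≤ c π i` for all
objectives `i` and policies `π ∈ S`, with all values in `[0,1]`, then the hypervolumes of
`S` under `V` and `Vt` differ by at most `∑_{π ∈ S} ∑_i c π i`. -/
theorem stmt_2 {P : Type*} {m : ℕ} (hm : 0 < m) (S : Finset P)
    (V Vt : P → Fin m → ℝ) (c : P → Fin m → ℝ)
    (hV : ∀ π ∈ S, ∀ i, V π i ∈ Set.Icc (0 : ℝ) 1)
    (hVt : ∀ π ∈ S, ∀ i, Vt π i ∈ Set.Icc (0 : ℝ) 1)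
    (hc0 : ∀ π ∈ S, ∀ i, 0 ≤ c π i)
    (hc : ∀ π ∈ S, ∀ i, |V π i - Vt π i| ≤ c π i) :
    |vol S V - vol S Vt| ≤ ∑ π ∈ S, ∑ i, c π i := by
  have h_le := vol_le_vol_add S V Vt c (fun π hπ i => (hV π hπ i).2) hc0
    fun π hπ i => (abs_sub_le_iff.1 (hc π hπ i)).1
  have h_ge := vol_le_vol_add S Vt V c (fun π hπ i => (hVt π hπ i).2) hc0
    fun π hπ i => (abs_sub_le_iff.1 (hc π hπ i)).2
  exact abs_sub_le_iff.2 ⟨by linarith, by linarith⟩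
end

section
/- Let Π be a nonempty finite set, m and K positive integers with K ≤ |Π|, and let V, V̂ : Π → [0,1]^m with coordinates V_i(π), V̂_i(π). Assume |V_i(π) − V̂_i(π)| ≤ c_i(π) for all i ∈ {1,…,m} and π ∈ Π, where c_i(π) ≥ 0, and define c(S) = Σ_{π ∈ S} Σ_{i=1}^m c_i(π) for S ⊆ Π. Let S* be a subset of Π of size K maximizing vol(S, V) over all subsets S ⊆ Π of size K. Let α ∈ [0,1] and let Ŝ ⊆ Π of size K satisfy vol(Ŝ, V̂) ≥ α · max_{S ⊆ Π, |S| = K} vol(S, V̂). Then vol(Ŝ, V) ≥ α · vol(S*, V) − c(S*) − c(Ŝ). -/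
open MeasureTheory

theorem volume_Icc_update_zero_one {m : ℕ} (i : Fin m) (a b : ℝ) :
    volume (Set.Icc (Function.update (0 : Fin m → ℝ) i b) (Function.update 1 i a)) =
      ENNReal.ofReal (a - b) := by
  rw [Real.volume_Icc_pi, Finset.prod_eq_single i]
  · simp
  · intro j _ hj
    simp [hj]
  · simp

theorem Icc_zero_subset_union_slabs {m : ℕ} {a : Fin m → ℝ} (b : Fin m → ℝ) (ha : a ≤ 1) :
    Set.Icc 0 a ⊆ Set.Icc 0 b ∪
      ⋃ i, Set.Icc (Function.update (0 : Fin m → ℝ) i (b i)) (Function.update 1 i (a i)) := by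
  rintro x ⟨hx0, hxa⟩
  by_cases hxb : x ≤ b
  · exact Or.inl ⟨hx0, hxb⟩
  · obtain ⟨i, hi⟩ : ∃ i, b i < x i := by simpa [Pi.le_def] using hxb
    refine Or.inr (Set.mem_iUnion.2 ⟨i, ?_, ?_⟩)
    · exact update_le_iff.2 ⟨hi.le, fun j _ => hx0 j⟩
    · exact le_update_iff.2 ⟨hxa i, fun j _ => (hxa j).trans (ha j)⟩

theorem volume_biUnion_Icc_ne_top {P : Type*} {m : ℕ} (S : Finset P) (V : P → Fin m → ℝ) :
    volume (⋃ π ∈ S, Set.Icc (0 : Fin m → ℝ) (V π)) ≠ ⊤ :=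
  (measure_biUnion_lt_top S.finite_toSet fun _ _ => isCompact_Icc.measure_lt_top).ne

/-- Changing the value function increases the hypervolume by at most the total increase of the
coordinates, as long as the new values are at most `1`. -/
theorem vol_le_vol_add_sum {P : Type*} {m : ℕ} (S : Finset P) {A B c : P → Fin m → ℝ}
    (hA : ∀ π, A π ≤ 1) (hc0 : ∀ π i, 0 ≤ c π i) (hc : ∀ π i, A π i - B π i ≤ c π i) :
    vol S A ≤ vol S B + ∑ π ∈ S, ∑ i, c π i := by
  have hsum : 0 ≤ ∑ π ∈ S, ∑ i, c π i :=
    Finset.sum_nonneg fun π _ => Finset.sum_nonneg fun i _ => hc0 π i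
  have key : volume (⋃ π ∈ S, Set.Icc 0 (A π)) ≤
      volume (⋃ π ∈ S, Set.Icc 0 (B π)) + ENNReal.ofReal (∑ π ∈ S, ∑ i, c π i) := by
    calc volume (⋃ π ∈ S, Set.Icc 0 (A π))
        ≤ volume ((⋃ π ∈ S, Set.Icc 0 (B π)) ∪ ⋃ π ∈ S, ⋃ i,
            Set.Icc (Function.update (0 : Fin m → ℝ) i (B π i))
              (Function.update 1 i (A π i))) := by
          refine measure_mono (Set.iUnion₂_subset fun π hπ => ?_)
          refine (Icc_zero_subset_union_slabs (B π) (hA π)).trans (Set.union_subset_union ?_ ?_)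
          · exact Set.subset_biUnion_of_mem (u := fun π => Set.Icc 0 (B π)) hπ
          · exact Set.subset_biUnion_of_mem (u := fun π => ⋃ i,
              Set.Icc (Function.update (0 : Fin m → ℝ) i (B π i))
                (Function.update 1 i (A π i))) hπ
      _ ≤ _ := by
          refine (measure_union_le _ _).trans (add_le_add le_rfl ?_)
          rw [ENNReal.ofReal_sum_of_nonneg fun π _ => Finset.sum_nonneg fun i _ => hc0 π i]
          refine (measure_biUnion_finset_le _ _).trans (Finset.sum_le_sum fun π _ => ?_)
          rw [ENNReal.ofReal_sum_of_nonneg fun i _ => hc0 π i]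
          refine (measure_iUnion_fintype_le _ _).trans (Finset.sum_le_sum fun i _ => ?_)
          rw [volume_Icc_update_zero_one]
          exact ENNReal.ofReal_le_ofReal (hc π i)
  have hfin := volume_biUnion_Icc_ne_top S B
  have h := ENNReal.toReal_mono (ENNReal.add_ne_top.2 ⟨hfin, ENNReal.ofReal_ne_top⟩) key
  rwa [ENNReal.toReal_add hfin ENNReal.ofReal_ne_top, ENNReal.toReal_ofReal hsum] at h

/-- **Theorem 1 (error bound for α-approximate hypervolume maximization with the mean
estimate).** If `Vh` estimates `V` with per-objective error at most `cf π i`, `Sstar` is a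
size-`K` maximizer of `vol · V`, and `Shat` is a size-`K` `α`-approximate maximizer of
`vol · Vh`, then `vol Shat V ≥ α * vol Sstar V - c Sstar - c Shat` where
`c S = ∑ π ∈ S, ∑ i, cf π i`. -/
theorem stmt_3 {P : Type*} [Fintype P] [Nonempty P] {m K : ℕ} (hm : 0 < m) (hK : 0 < K)
    (hKcard : K ≤ Fintype.card P)
    (V Vh : P → Fin m → ℝ) (cf : P → Fin m → ℝ)
    (hV : ∀ π i, V π i ∈ Set.Icc (0 : ℝ) 1)
    (hVh : ∀ π i, Vh π i ∈ Set.Icc (0 : ℝ) 1)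
    (hc0 : ∀ π i, 0 ≤ cf π i)
    (hc : ∀ π i, |V π i - Vh π i| ≤ cf π i)
    (Sstar : Finset P) (hSstarcard : Sstar.card = K)
    (hSstarmax : ∀ S : Finset P, S.card = K → vol S V ≤ vol Sstar V)
    (α : ℝ) (hα0 : 0 ≤ α) (hα1 : α ≤ 1)
    (Shat : Finset P) (hShatcard : Shat.card = K)
    (happrox : ∀ S : Finset P, S.card = K → α * vol S Vh ≤ vol Shat Vh) :
    vol Shat V ≥
      α * vol Sstar V - (∑ π ∈ Sstar, ∑ i, cf π i) - (∑ π ∈ Shat, ∑ i, cf π i) := by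
  have h_hat : vol Shat Vh ≤ vol Shat V + ∑ π ∈ Shat, ∑ i, cf π i :=
    vol_le_vol_add_sum Shat (fun π i => (hVh π i).2) hc0
      fun π i => by linarith [(abs_le.1 (hc π i)).1]
  have h_star : vol Sstar V ≤ vol Sstar Vh + ∑ π ∈ Sstar, ∑ i, cf π i :=
    vol_le_vol_add_sum Sstar (fun π i => (hV π i).2) hc0 fun π i => (abs_le.1 (hc π i)).2
  have h_sum : 0 ≤ ∑ π ∈ Sstar, ∑ i, cf π i :=
    Finset.sum_nonneg fun π _ => Finset.sum_nonneg fun i _ => hc0 π i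
  have h_mul := mul_le_mul_of_nonneg_left h_star hα0
  have h_scale := mul_le_of_le_one_left h_sum hα1
  linarith [happrox Sstar hSstarcard]
end

section
/- Let K be a positive integer, a ∈ ℝ a reference point, and f_1, f_2 : {1,…,K} → ℝ with f_1(k) ≥ a and f_2(k) ≥ a for all k, and with f_1(1) ≤ f_1(2) ≤ … ≤ f_1(K). Then the Lebesgue measure of ⋃_{k=1}^K ([a, f_1(k)] × [a, f_2(k)]) ⊆ ℝ² equals (f_1(1) − a) · (max_{k ∈ {1,…,K}} f_2(k) − a) + Σ_{k=1}^{K−1} (f_1(k+1) − f_1(k)) · (max_{ℓ ∈ {k+1,…,K}} f_2(ℓ) − a). -/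
open MeasureTheory

/-- The finite maximum over an integer interval is attained. -/
theorem exists_eq_sSup_image_Icc (f : ℕ → ℝ) {n K : ℕ} (hn : n ≤ K) :
    ∃ l ∈ Set.Icc n K, f l = sSup (f '' Set.Icc n K) :=
  ((Set.nonempty_Icc.2 hn).image f).csSup_mem ((Set.finite_Icc n K).image f)

theorem le_sSup_image_Icc (f : ℕ → ℝ) {n K k : ℕ} (hk : k ∈ Set.Icc n K) :
    f k ≤ sSup (f '' Set.Icc n K) :=
  le_csSup ((Set.finite_Icc n K).image f).bddAbove (Set.mem_image_of_mem f hk)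

/-- The union of the rectangles splits into the vertical strip over `(b, f1 n]` and the part
to the right of `f1 n`. -/
theorem iUnion_rectangles_eq_strip_union {n K : ℕ} (hn : n ≤ K) {a b : ℝ} {f1 : ℕ → ℝ}
    (f2 : ℕ → ℝ) (hmono : ∀ k ∈ Set.Icc n K, f1 n ≤ f1 k) (hb : b ≤ f1 n) :
    (⋃ k ∈ Finset.Icc n K, Set.Ioc b (f1 k) ×ˢ Set.Icc a (f2 k)) =
      Set.Ioc b (f1 n) ×ˢ Set.Icc a (sSup (f2 '' Set.Icc n K)) ∪
        ⋃ k ∈ Finset.Icc (n + 1) K, Set.Ioc (f1 n) (f1 k) ×ˢ Set.Icc a (f2 k) := by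
  ext ⟨x, y⟩
  simp only [Set.mem_iUnion, Set.mem_union, Set.mem_prod, Set.mem_Ioc, Set.mem_Icc,
    Finset.mem_Icc, exists_prop]
  constructor
  · rintro ⟨k, hk, ⟨hbx, hxk⟩, hay, hyk⟩
    rcases le_or_gt x (f1 n) with hx | hx
    · exact Or.inl ⟨⟨hbx, hx⟩, hay, hyk.trans (le_sSup_image_Icc f2 hk)⟩
    · have hne : k ≠ n := by
        rintro rfl
        exact absurd hxk hx.not_ge
      exact Or.inr ⟨k, ⟨by lia, hk.2⟩, ⟨hx, hxk⟩, hay, hyk⟩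
  · rintro (⟨⟨hbx, hx⟩, hay, hy⟩ | ⟨k, hk, ⟨hx, hxk⟩, hay, hyk⟩)
    · obtain ⟨l, hl, hlM⟩ := exists_eq_sSup_image_Icc f2 hn
      exact ⟨l, hl, ⟨hbx, hx.trans (hmono l hl)⟩, hay, hlM ▸ hy⟩
    · exact ⟨k, ⟨by lia, hk.2⟩, ⟨hb.trans_lt hx, hxk⟩, hay, hyk⟩

theorem volume_iUnion_rectangles_succ {n K : ℕ} (hn : n ≤ K) {a b : ℝ} {f1 : ℕ → ℝ}
    (f2 : ℕ → ℝ) (hmono : ∀ k ∈ Set.Icc n K, f1 n ≤ f1 k) (hb : b ≤ f1 n) :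
    volume (⋃ k ∈ Finset.Icc n K, Set.Ioc b (f1 k) ×ˢ Set.Icc a (f2 k)) =
      ENNReal.ofReal ((f1 n - b) * (sSup (f2 '' Set.Icc n K) - a)) +
        volume (⋃ k ∈ Finset.Icc (n + 1) K, Set.Ioc (f1 n) (f1 k) ×ˢ Set.Icc a (f2 k)) := by
  rw [iUnion_rectangles_eq_strip_union hn f2 hmono hb, measure_union]
  · rw [Measure.volume_eq_prod, Measure.prod_prod, Real.volume_Ioc, Real.volume_Icc,
      ENNReal.ofReal_mul (sub_nonneg.2 hb)]
  · rw [Set.disjoint_left]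
    rintro ⟨x, y⟩ hxy hxy'
    simp only [Set.mem_iUnion, Set.mem_prod, Set.mem_Ioc, exists_prop] at hxy hxy'
    obtain ⟨k, -, hx, -⟩ := hxy'
    exact absurd hxy.1.2 hx.1.not_ge
  · exact Finset.measurableSet_biUnion _ fun k _ => measurableSet_Ioc.prod measurableSet_Icc

theorem volume_iUnion_rectangles_Ioc {p K : ℕ} (hp : p ≤ K) {a b : ℝ} {f1 f2 : ℕ → ℝ}
    (hmono : MonotoneOn f1 (Set.Icc p K)) (hf2 : ∀ k ∈ Set.Icc p K, a ≤ f2 k)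
    (hb : b ≤ f1 p) :
    volume (⋃ k ∈ Finset.Icc p K, Set.Ioc b (f1 k) ×ˢ Set.Icc a (f2 k)) =
      ENNReal.ofReal ((f1 p - b) * (sSup (f2 '' Set.Icc p K) - a) +
        ∑ k ∈ Finset.Ico p K, (f1 (k + 1) - f1 k) * (sSup (f2 '' Set.Icc (k + 1) K) - a)) := by
  induction hp using Nat.decreasingInduction generalizing b with
  | self =>
    rw [volume_iUnion_rectangles_succ le_rfl f2 (by simp) hb]
    simp
  | of_succ n hn ih =>
    have hsub : Set.Icc (n + 1) K ⊆ Set.Icc n K := Set.Icc_subset_Icc_left n.le_succ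
    have hmem : n ∈ Set.Icc n K := ⟨le_rfl, hn.le⟩
    have hstep : ∀ k ∈ Set.Ico n K, f1 k ≤ f1 (k + 1) := fun k hk =>
      hmono ⟨hk.1, hk.2.le⟩ ⟨hk.1.trans k.le_succ, hk.2⟩ k.le_succ
    have hM : ∀ k ∈ Set.Icc n K, 0 ≤ sSup (f2 '' Set.Icc k K) - a := fun k hk =>
      sub_nonneg.2 ((hf2 k hk).trans (le_sSup_image_Icc f2 ⟨le_rfl, hk.2⟩))
    have hterm : ∀ k ∈ Set.Ico n K,
        0 ≤ (f1 (k + 1) - f1 k) * (sSup (f2 '' Set.Icc (k + 1) K) - a) := fun k hk =>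
      mul_nonneg (sub_nonneg.2 (hstep k hk)) (hM (k + 1) ⟨hk.1.trans k.le_succ, hk.2⟩)
    rw [volume_iUnion_rectangles_succ hn.le f2 (fun k hk => hmono hmem hk hk.1) hb,
      ih (hmono.mono hsub) (fun k hk => hf2 k (hsub hk)) (hstep n ⟨le_rfl, hn⟩),
      Finset.sum_eq_sum_Ico_succ_bot hn, ← ENNReal.ofReal_add]
    · exact mul_nonneg (sub_nonneg.2 hb) (hM n hmem)
    · exact add_nonneg (hterm n ⟨le_rfl, hn⟩) (Finset.sum_nonneg fun k hk =>
        hterm k (Set.Ico_subset_Ico_left n.le_succ (Finset.mem_Ico.1 hk)))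

/-- Closing the rectangles on the left does not change the area of their union. -/
theorem volume_iUnion_rectangles_Icc (s : Finset ℕ) (a b : ℝ) (f1 f2 : ℕ → ℝ) :
    volume (⋃ k ∈ s, Set.Icc b (f1 k) ×ˢ Set.Icc a (f2 k)) =
      volume (⋃ k ∈ s, Set.Ioc b (f1 k) ×ˢ Set.Icc a (f2 k)) := by
  refine measure_congr (Filter.EventuallyEq.symm ?_)
  refine Filter.EventuallyEq.countable_bUnion s.countable_toSet fun k _ => ?_
  exact Measure.set_prod_ae_eq Ioc_ae_eq_Icc Filter.EventuallyEq.rfl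

/-- **Exact two-objective hypervolume formula (Appendix, Two Objectives).** For points
`(f1 k, f2 k)`, `k ∈ {1, …, K}`, dominating the reference point `(a, a)` and sorted by
the first coordinate, the area of `⋃_k [a, f1 k] × [a, f2 k]` equals
`(f1 1 - a) (max_{k ∈ {1..K}} f2 k - a) +
  ∑_{k=1}^{K-1} (f1 (k+1) - f1 k) (max_{ℓ ∈ {k+1..K}} f2 ℓ - a)`. -/
theorem stmt_14 (K : ℕ) (hK : 0 < K) (a : ℝ) (f1 f2 : ℕ → ℝ)
    (hf1 : ∀ k ∈ Finset.Icc 1 K, a ≤ f1 k)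
    (hf2 : ∀ k ∈ Finset.Icc 1 K, a ≤ f2 k)
    (hsorted : ∀ k ∈ Finset.Icc 1 (K - 1), f1 k ≤ f1 (k + 1)) :
    (volume (⋃ k ∈ Finset.Icc 1 K, Set.Icc a (f1 k) ×ˢ Set.Icc a (f2 k))).toReal =
      (f1 1 - a) * (sSup (f2 '' Set.Icc 1 K) - a) +
        ∑ k ∈ Finset.Icc 1 (K - 1),
          (f1 (k + 1) - f1 k) * (sSup (f2 '' Set.Icc (k + 1) K) - a) := by
  have hmono : MonotoneOn f1 (Set.Icc 1 K) :=
    monotoneOn_of_le_add_one Set.ordConnected_Icc fun k _ hk hk' =>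
      hsorted k (Finset.mem_Icc.2 ⟨hk.1, Nat.le_sub_one_of_lt hk'.2⟩)
  have hIcc : Finset.Icc 1 (K - 1) = Finset.Ico 1 K := by
    ext k
    simp only [Finset.mem_Icc, Finset.mem_Ico]
    lia
  have ha : a ≤ f1 1 := hf1 1 (Finset.mem_Icc.2 ⟨le_rfl, hK⟩)
  rw [volume_iUnion_rectangles_Icc, volume_iUnion_rectangles_Ioc hK hmono
    (fun k hk => hf2 k (Finset.mem_Icc.2 hk)) ha, hIcc, ENNReal.toReal_ofReal]
  have hM : ∀ k ∈ Set.Icc 1 K, 0 ≤ sSup (f2 '' Set.Icc k K) - a := fun k hk =>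
    sub_nonneg.2 ((hf2 k (Finset.mem_Icc.2 hk)).trans (le_sSup_image_Icc f2 ⟨le_rfl, hk.2⟩))
  refine add_nonneg (mul_nonneg (sub_nonneg.2 ha) (hM 1 ⟨le_rfl, hK⟩))
    (Finset.sum_nonneg fun k hk => ?_)
  have hk' := Finset.mem_Ico.1 hk
  exact mul_nonneg (sub_nonneg.2 (hsorted k (hIcc ▸ hk))) (hM (k + 1) ⟨by lia, hk'.2⟩)
end
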